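/- For every z ∈ ℂ ∖ ℝ, the Weyl–Titchmarsh function admits the finite continued fraction expansion M(z) = 1 + M_N(z), where the rational functions M_0,…,M_N are defined recursively by 1/M_0(z) = −l_0 and 1/M_n(z) = −l_n + 1/( m_n(z) + M_{n−1}(z) ) for n = 1,…,N. Here l_0 = (1/2)(tanh(x_1/2) + 1), l_n = (1/2)(tanh(x_{n+1}/2) − tanh(x_n/2)) for n = 1,…,N−1, l_N = (1/2)(1 − tanh(x_N/2)), and m_n(z) = (z ω_n + z² υ_n) · 4 cosh²(x_n/2) for n = 1,…,N. -/

import Mathlib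

open scoped BigOperators

/-- Transfer matrix across an interval of length `d` for `-f'' + (1/4) f = 0`. -/
noncomputable def Tmat (d : ℝ) : Matrix (Fin 2) (Fin 2) ℂ :=
  !![Complex.cosh ((d : ℂ) / 2), 2 * Complex.sinh ((d : ℂ) / 2);
     (1 / 2) * Complex.sinh ((d : ℂ) / 2), Complex.cosh ((d : ℂ) / 2)]

/-- Interface matrix at a point carrying weight `w` and dipole `v`. -/
noncomputable def Omat (w v : ℝ) (z : ℂ) : Matrix (Fin 2) (Fin 2) ℂ :=
  !![1, 0; -(z * (w : ℂ) + z ^ 2 * (v : ℂ)), 1]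

/-- The value `(φ₋(z, x_N+), φ₋'(z, x_N+))` obtained by propagating the initial data
`(e^{x_0/2}, (1/2) e^{x_0/2})` through all the point interactions (0-indexed data). -/
noncomputable def transVec (N : ℕ) (x w v : ℕ → ℝ) (z : ℂ) : Fin 2 → ℂ :=
  Matrix.mulVec
    ((((List.range (N - 1)).reverse.map
        (fun j => Omat (w (j + 1)) (v (j + 1)) z * Tmat (x (j + 1) - x j))).prod)
      * Omat (w 0) (v 0) z)
    ![Complex.exp ((x 0 : ℂ) / 2), (1 / 2) * Complex.exp ((x 0 : ℂ) / 2)]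

/-- The Wronskian polynomial `W(z)` of the generalized spectral problem
`-f'' + (1/4) f = z ω f + z² υ f` (`W ≡ 1` when `N = 0`). -/
noncomputable def Wron (N : ℕ) (x w v : ℕ → ℝ) (z : ℂ) : ℂ :=
  if N = 0 then 1
  else Complex.exp (-(x (N - 1) : ℂ) / 2) *
    (transVec N x w v z 1 + (1 / 2) * transVec N x w v z 0)

/-- The Weyl--Titchmarsh function `M(z)`. -/
noncomputable def WeylM (N : ℕ) (x w v : ℕ → ℝ) (z : ℂ) : ℂ :=
  Complex.exp ((x (N - 1) : ℂ) / 2) *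
    ((1 / 2) * transVec N x w v z 0 - transVec N x w v z 1) / Wron N x w v z

/-- `f` (with distributional derivative represented by `f'`) is a solution at `z` of the
generalized spectral problem `-f'' + (1/4) f = z ω f + z² υ f` with
`ω = Σ_{n<N} w n δ_{x n}`, `υ = Σ_{n<N} v n δ_{x n}`: it is continuous, twice differentiable
away from the points `x n` with `f'' = (1/4) f` there, and the one-sided limits of `f'` at
each `x n` exist and satisfy the jump condition
`f'(x_n+) - f'(x_n-) = -(z w_n + z² v_n) f (x_n)`. -/
def IsSol (N : ℕ) (x w v : ℕ → ℝ) (z : ℂ) (f f' : ℝ → ℂ) : Prop :=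
  Continuous f ∧
  (∀ t : ℝ, (∀ n < N, t ≠ x n) →
    HasDerivAt f (f' t) t ∧ HasDerivAt f' ((1 / 4) * f t) t) ∧
  (∀ n < N, ∃ L R : ℂ,
    Filter.Tendsto f' (nhdsWithin (x n) (Set.Iio (x n))) (nhds L) ∧
    Filter.Tendsto f' (nhdsWithin (x n) (Set.Ioi (x n))) (nhds R) ∧
    R - L = -(z * (w n : ℂ) + z ^ 2 * (v n : ℂ)) * f (x n))

/-- The coefficients `l_0, …, l_N` of the continued fraction (0-indexed points). -/
noncomputable def lcoef (N : ℕ) (x : ℕ → ℝ) (n : ℕ) : ℝ :=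
  if n = 0 then (1 / 2) * (Real.tanh (x 0 / 2) + 1)
  else if n < N then (1 / 2) * (Real.tanh (x n / 2) - Real.tanh (x (n - 1) / 2))
  else (1 / 2) * (1 - Real.tanh (x (N - 1) / 2))

/-- The polynomial coefficients `m_{n+1}(z) = (z ω_{n+1} + z² υ_{n+1}) 4 cosh²(x_{n+1}/2)`
of the continued fraction (`n` is the 0-based index). -/
noncomputable def mcoef (x w v : ℕ → ℝ) (n : ℕ) (z : ℂ) : ℂ :=
  (z * (w n : ℂ) + z ^ 2 * (v n : ℂ)) * 4 * Complex.cosh ((x n : ℂ) / 2) ^ 2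

/-- The recursively defined rational functions `M_0, …, M_N`:
`1/M_0 = -l_0` and `1/M_n(z) = -l_n + 1/( m_n(z) + M_{n-1}(z) )`. -/
noncomputable def Mcf (N : ℕ) (x w v : ℕ → ℝ) : ℕ → ℂ → ℂ
  | 0 => fun _ => -1 / ((lcoef N x 0 : ℝ) : ℂ)
  | n + 1 => fun z =>
      1 / (-((lcoef N x (n + 1) : ℝ) : ℂ)
        + 1 / (mcoef x w v n z + Mcf N x w v n z))

/-- A strengthened nonvanishing condition: `M / z` has imaginary part of the same sign as `z`. -/
def HerglotzAt (z M : ℂ) : Prop := 0 < (M / z).im * z.im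

namespace HerglotzAt

variable {z M : ℂ}

theorem inv_im_mul_pos {u : ℂ} {y : ℝ} (h : u.im * y < 0) : 0 < u⁻¹.im * y := by
  have hu : u ≠ 0 := by
    rintro rfl
    simp at h
  rw [Complex.inv_im, div_mul_eq_mul_div]
  exact div_pos (by linarith) (Complex.normSq_pos.2 hu)

theorem inv_im_mul_neg {u : ℂ} {y : ℝ} (h : 0 < u.im * y) : u⁻¹.im * y < 0 := by
  have := inv_im_mul_pos (u := u) (y := -y) (by linarith)
  linarith

theorem ne_zero (h : HerglotzAt z M) : M ≠ 0 := by
  rintro rfl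
  simp [HerglotzAt] at h

theorem neg_one_div (hz : z.im ≠ 0) {l : ℝ} (hl : 0 < l) : HerglotzAt z (-1 / (l : ℂ)) := by
  have h : (-1 / (l : ℂ)) / z = (-((l : ℂ) * z))⁻¹ := by
    rw [div_div, neg_div, one_div, inv_neg]
  rw [HerglotzAt, h]
  apply inv_im_mul_pos
  rw [Complex.neg_im, Complex.im_ofReal_mul]
  nlinarith [mul_pos hl (mul_self_pos.2 hz)]

theorem add_mass (h : HerglotzAt z M) (hz : z.im ≠ 0) (w : ℝ) {v c : ℝ} (hv : 0 ≤ v) :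
    HerglotzAt z ((z * (w : ℂ) + z ^ 2 * (v : ℂ)) * 4 * (c : ℂ) ^ 2 + M) := by
  have hz0 : z ≠ 0 := by
    rintro rfl
    simp at hz
  have e : ((z * (w : ℂ) + z ^ 2 * (v : ℂ)) * 4 * (c : ℂ) ^ 2 + M) / z
      = ((4 * c ^ 2 * w : ℝ) : ℂ) + ((4 * c ^ 2 * v : ℝ) : ℂ) * z + M / z := by
    push_cast
    field_simp
  rw [HerglotzAt] at h ⊢
  rw [e, Complex.add_im, Complex.add_im, Complex.ofReal_im, Complex.im_ofReal_mul]
  have : 0 ≤ 4 * c ^ 2 * v * (z.im * z.im) :=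
    mul_nonneg (by positivity) (mul_self_nonneg _)
  nlinarith

theorem neg_add_one_div_ne_zero_and (h : HerglotzAt z M) (hz : z.im ≠ 0) {l : ℝ} (hl : 0 ≤ l) :
    -(l : ℂ) + 1 / M ≠ 0 ∧ HerglotzAt z (1 / (-(l : ℂ) + 1 / M)) := by
  have hz0 : z ≠ 0 := by
    rintro rfl
    simp at hz
  have hM := h.ne_zero
  have e : -(l : ℂ) * z + (M / z)⁻¹ = z * (-(l : ℂ) + 1 / M) := by
    field_simp
  have him : (z * (-(l : ℂ) + 1 / M)).im * z.im < 0 := by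
    have h1 := inv_im_mul_neg h
    rw [← e, Complex.add_im, neg_mul, Complex.neg_im, Complex.im_ofReal_mul]
    nlinarith [mul_nonneg hl (mul_self_nonneg z.im)]
  refine ⟨fun h0 => ?_, ?_⟩
  · rw [h0] at him
    simp at him
  · have := inv_im_mul_pos him
    rwa [HerglotzAt, div_div, one_div, mul_comm _ z]

end HerglotzAt

theorem tanh_half_lt {a b : ℝ} (h : a < b) : Real.tanh (a / 2) < Real.tanh (b / 2) := by
  have h0 : 0 < Real.sinh (b / 2 - a / 2) := Real.sinh_pos_iff.2 (by linarith)
  rw [Real.sinh_sub] at h0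
  rw [Real.tanh_eq_sinh_div_cosh, Real.tanh_eq_sinh_div_cosh,
    div_lt_div_iff₀ (Real.cosh_pos _) (Real.cosh_pos _)]
  linarith

theorem transVec_one (x w v : ℕ → ℝ) (z : ℂ) :
    transVec 1 x w v z = ![Complex.exp ((x 0 : ℂ) / 2),
      (1 / 2) * Complex.exp ((x 0 : ℂ) / 2)
        - (z * (w 0 : ℂ) + z ^ 2 * (v 0 : ℂ)) * Complex.exp ((x 0 : ℂ) / 2)] := by
  ext i
  fin_cases i
  · simp [transVec, Omat]
  · simp [transVec, Omat]
    ring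

theorem transVec_succ (n : ℕ) (x w v : ℕ → ℝ) (z : ℂ) :
    transVec (n + 2) x w v z = Matrix.mulVec
      (Omat (w (n + 1)) (v (n + 1)) z * Tmat (x (n + 1) - x n)) (transVec (n + 1) x w v z) := by
  rw [transVec, transVec, Matrix.mulVec_mulVec, Nat.add_sub_cancel,
    show n + 2 - 1 = n + 1 from rfl, List.range_succ, List.reverse_append, List.reverse_singleton,
    List.singleton_append, List.map_cons, List.prod_cons, Matrix.mul_assoc]

theorem transVec_succ_zero (n : ℕ) (x w v : ℕ → ℝ) (z : ℂ) :
    transVec (n + 2) x w v z 0 =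
      Complex.cosh ((x (n + 1) : ℂ) / 2 - (x n : ℂ) / 2) * transVec (n + 1) x w v z 0
      + 2 * Complex.sinh ((x (n + 1) : ℂ) / 2 - (x n : ℂ) / 2) * transVec (n + 1) x w v z 1 := by
  rw [transVec_succ, ← sub_div]
  simp [Omat, Tmat, Matrix.mulVec, dotProduct, Fin.sum_univ_two]

theorem transVec_succ_one (n : ℕ) (x w v : ℕ → ℝ) (z : ℂ) :
    transVec (n + 2) x w v z 1 =
      (1 / 2) * Complex.sinh ((x (n + 1) : ℂ) / 2 - (x n : ℂ) / 2) * transVec (n + 1) x w v z 0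
      + Complex.cosh ((x (n + 1) : ℂ) / 2 - (x n : ℂ) / 2) * transVec (n + 1) x w v z 1
      - (z * (w (n + 1) : ℂ) + z ^ 2 * (v (n + 1) : ℂ)) * transVec (n + 2) x w v z 0 := by
  rw [transVec_succ_zero, transVec_succ, ← sub_div]
  simp [Omat, Tmat, Matrix.mulVec, dotProduct, Fin.sum_univ_two]
  ring

theorem cosh_ofReal_half_ne_zero (t : ℝ) : Complex.cosh ((t : ℂ) / 2) ≠ 0 := by
  have h : Complex.cosh ((t : ℂ) / 2) = ((Real.cosh (t / 2) : ℝ) : ℂ) := by push_cast; rfl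
  rw [h]
  exact_mod_cast (Real.cosh_pos _).ne'

theorem mcoef_add_herglotzAt {z M : ℂ} (h : HerglotzAt z M) (hz : z.im ≠ 0) (x w v : ℕ → ℝ)
    {n : ℕ} (hv : 0 ≤ v n) : HerglotzAt z (mcoef x w v n z + M) := by
  have := h.add_mass hz (w n) (c := Real.cosh (x n / 2)) hv
  simpa [mcoef] using this

/-- The truncated continued fraction is the logarithmic derivative, up to sign, of the
Liouville transform `φ₋ / cosh (· / 2)` of the solution to the right of `x n`. -/
theorem mcoef_add_Mcf_spec (N : ℕ) (x w v : ℕ → ℝ)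
    (hx : ∀ i j, i < j → j < N → x i < x j) (hv : ∀ n, n < N → 0 ≤ v n)
    {z : ℂ} (hz : z.im ≠ 0) (n : ℕ) (hn : n < N) :
    HerglotzAt z (mcoef x w v n z + Mcf N x w v n z) ∧ transVec (n + 1) x w v z 0 ≠ 0 ∧
      (mcoef x w v n z + Mcf N x w v n z) * transVec (n + 1) x w v z 0 =
        -4 * Complex.cosh ((x n : ℂ) / 2) *
          (transVec (n + 1) x w v z 1 * Complex.cosh ((x n : ℂ) / 2)
            - transVec (n + 1) x w v z 0 * Complex.sinh ((x n : ℂ) / 2) / 2) := by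
  induction n with
  | zero =>
    have hl : 0 < lcoef N x 0 := by
      simp only [lcoef, if_true]
      linarith [Real.neg_one_lt_tanh (x 0 / 2)]
    refine ⟨mcoef_add_herglotzAt (HerglotzAt.neg_one_div hz hl) hz x w v (hv 0 hn), ?_, ?_⟩
    · simp [transVec_one, Complex.exp_ne_zero]
    · have hc := cosh_ofReal_half_ne_zero (x 0)
      have he : Complex.exp ((x 0 : ℂ) / 2) ≠ 0 := Complex.exp_ne_zero _
      have hsum := Complex.cosh_add_sinh ((x 0 : ℂ) / 2)
      have hsq := Complex.cosh_sq_sub_sinh_sq ((x 0 : ℂ) / 2)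
      have hle : ((lcoef N x 0 : ℝ) : ℂ) =
          Complex.exp ((x 0 : ℂ) / 2) / (2 * Complex.cosh ((x 0 : ℂ) / 2)) := by
        simp only [lcoef, if_true]
        push_cast
        rw [Complex.tanh_eq_sinh_div_cosh, ← hsum]
        field_simp
        ring
      simp only [Mcf, hle, mcoef, zero_add, transVec_one, Matrix.cons_val_zero, Matrix.cons_val_one,
        Matrix.cons_val_fin_one]
      generalize Complex.exp ((x 0 : ℂ) / 2) = E at *
      field_simp
      rw [← hsum]
      linear_combination 4 * hsq
  | succ n ih =>
    obtain ⟨hX, hf, hrel⟩ := ih (by omega)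
    have hlt : x n < x (n + 1) := hx n (n + 1) (by omega) hn
    have hl : 0 ≤ lcoef N x (n + 1) := by
      simp only [lcoef, hn, if_true, Nat.add_sub_cancel, Nat.add_one_ne_zero, if_false]
      linarith [tanh_half_lt hlt]
    obtain ⟨hne, hH⟩ := hX.neg_add_one_div_ne_zero_and hz hl
    have hX0 := hX.ne_zero
    have ha := cosh_ofReal_half_ne_zero (x n)
    have hb := cosh_ofReal_half_ne_zero (x (n + 1))
    have hsa := Complex.cosh_sq_sub_sinh_sq ((x n : ℂ) / 2)
    have hsb := Complex.cosh_sq_sub_sinh_sq ((x (n + 1) : ℂ) / 2)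
    have hle : ((lcoef N x (n + 1) : ℝ) : ℂ) =
        (Complex.sinh ((x (n + 1) : ℂ) / 2) / Complex.cosh ((x (n + 1) : ℂ) / 2)
          - Complex.sinh ((x n : ℂ) / 2) / Complex.cosh ((x n : ℂ) / 2)) / 2 := by
      simp only [lcoef, hn, if_true, Nat.add_sub_cancel, Nat.add_one_ne_zero, if_false]
      push_cast
      rw [Complex.tanh_eq_sinh_div_cosh, Complex.tanh_eq_sinh_div_cosh]
      ring
    have hM : Mcf N x w v (n + 1) z = 1 / (-((lcoef N x (n + 1) : ℝ) : ℂ)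
        + 1 / (mcoef x w v n z + Mcf N x w v n z)) := rfl
    have hf0 := transVec_succ_zero n x w v z
    have hf1 := transVec_succ_one n x w v z
    rw [Complex.cosh_sub, Complex.sinh_sub] at hf0 hf1
    rw [hM]
    have hm : mcoef x w v (n + 1) z = (z * (w (n + 1) : ℂ) + z ^ 2 * (v (n + 1) : ℂ)) * 4
      * Complex.cosh ((x (n + 1) : ℂ) / 2) ^ 2 := rfl
    refine ⟨mcoef_add_herglotzAt hH hz x w v (hv _ hn), ?_⟩
    rw [hm]
    clear hm hM hH
    generalize mcoef x w v n z + Mcf N x w v n z = X at *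
    generalize transVec (n + 1) x w v z 0 = f at *
    generalize transVec (n + 1) x w v z 1 = p at *
    generalize transVec (n + 2) x w v z 0 = f' at *
    generalize transVec (n + 2) x w v z 1 = p' at *
    generalize Complex.cosh ((x n : ℂ) / 2) = ca at *
    generalize Complex.sinh ((x n : ℂ) / 2) = sa at *
    generalize Complex.cosh ((x (n + 1) : ℂ) / 2) = cb at *
    generalize Complex.sinh ((x (n + 1) : ℂ) / 2) = sb at *
    generalize (lcoef N x (n + 1) : ℂ) = l at *
    generalize z * (w (n + 1) : ℂ) + z ^ 2 * (v (n + 1) : ℂ) = m at *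
    have key : f' * ca = cb * f * X * (-l + 1 / X) := by
      have e : cb * f * X * (-l + 1 / X) = cb * f - cb * l * (X * f) := by
        field_simp
        ring
      rw [e, hrel, hle, hf0]
      field_simp
      linear_combination (4 * f * cb) * hsa
    have hf' : f' ≠ 0 := by
      intro h
      rw [h, zero_mul] at key
      exact mul_ne_zero (mul_ne_zero (mul_ne_zero hb hf) hX0) hne key.symm
    refine ⟨hf', ?_⟩
    have hM' : 1 / (-l + 1 / X) * f' * ca = cb * (X * f) := by
      generalize -l + 1 / X = D at *
      rw [mul_assoc, key]
      field_simp
    apply mul_right_cancel₀ ha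
    rw [add_mul, add_mul, hM', hrel, hf1, hf0]
    linear_combination (4 * cb * ca ^ 2 * p - 2 * cb * ca * sa * f) * hsb

/-- the finite continued fraction expansion `M(z) = 1 + M_N(z)` of the
Weyl--Titchmarsh function, valid for all nonreal `z`. -/
theorem stmt_9 (N : ℕ) (hN : 1 ≤ N) (x w v : ℕ → ℝ)
    (hx : ∀ i j, i < j → j < N → x i < x j)
    (hv : ∀ n, n < N → 0 ≤ v n) (hnd : ∀ n, n < N → 0 < |w n| + v n) :
    ∀ z : ℂ, z.im ≠ 0 → WeylM N x w v z = 1 + Mcf N x w v N z := by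
  intro z hz
  obtain ⟨n, rfl⟩ : ∃ n, N = n + 1 := ⟨N - 1, by omega⟩
  obtain ⟨hX, hf, hrel⟩ := mcoef_add_Mcf_spec (n + 1) x w v hx hv hz n (by omega)
  have hl : 0 ≤ lcoef (n + 1) x (n + 1) := by
    simp only [lcoef, lt_irrefl, Nat.add_sub_cancel, Nat.add_one_ne_zero, if_false]
    linarith [Real.tanh_lt_one (x n / 2)]
  obtain ⟨hne, -⟩ := hX.neg_add_one_div_ne_zero_and hz hl
  have hX0 := hX.ne_zero
  have hc := cosh_ofReal_half_ne_zero (x n)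
  have hle : ((lcoef (n + 1) x (n + 1) : ℝ) : ℂ) =
      (1 - Complex.sinh ((x n : ℂ) / 2) / Complex.cosh ((x n : ℂ) / 2)) / 2 := by
    simp only [lcoef, lt_irrefl, Nat.add_sub_cancel, Nat.add_one_ne_zero, if_false]
    push_cast
    rw [Complex.tanh_eq_sinh_div_cosh]
    ring
  have hM : Mcf (n + 1) x w v (n + 1) z = 1 / (-((lcoef (n + 1) x (n + 1) : ℝ) : ℂ)
      + 1 / (mcoef x w v n z + Mcf (n + 1) x w v n z)) := rfl
  have hsq := Complex.cosh_sq_sub_sinh_sq ((x n : ℂ) / 2)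
  rw [hM]
  simp only [WeylM, Wron, Nat.add_sub_cancel, Nat.add_one_ne_zero, if_false, neg_div]
  rw [← Complex.cosh_add_sinh, ← Complex.cosh_sub_sinh]
  clear hM
  generalize mcoef x w v n z + Mcf (n + 1) x w v n z = X at *
  generalize transVec (n + 1) x w v z 0 = f at *
  generalize transVec (n + 1) x w v z 1 = p at *
  generalize Complex.cosh ((x n : ℂ) / 2) = c at *
  generalize Complex.sinh ((x n : ℂ) / 2) = s at *
  generalize (lcoef (n + 1) x (n + 1) : ℂ) = l at *
  have key : 2 * ((c - s) * (p + 1 / 2 * f)) * c = f * X * (-l + 1 / X) := by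
    have e : f * X * (-l + 1 / X) = f - l * (X * f) := by
      field_simp
      ring
    rw [e, hrel, hle]
    field_simp
    linear_combination 4 * f * hsq
  have hW : (c - s) * (p + 1 / 2 * f) ≠ 0 := by
    intro h
    rw [h, mul_zero, zero_mul] at key
    exact mul_ne_zero (mul_ne_zero hf hX0) hne key.symm
  generalize -l + 1 / X = D at *
  rw [div_eq_iff hW, one_add_mul]
  have h2 : 1 / D * ((c - s) * (p + 1 / 2 * f)) = X * f / (2 * c) := by
    field_simp
    linear_combination key
  rw [h2, hrel]
  field_simp
  ring
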